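/- Let n ≥ 2 and let α ∈ [−1, 1] be a real number satisfying α < −1/(n−1) or α > 1/n. Then the Werner state ρ = (1/(n² − nα))·(I − α·S) on ℂ^n ⊗ ℂ^n is not absolutely PPT; that is, there exists a unitary matrix U indexed by Fin n × Fin n such that the partial transpose of UρU† is not positive semidefinite. -/

import Mathlib

open Matrix BigOperators
open scoped ComplexOrder

noncomputable section

/-- The partial transpose (on the second factor) of a matrix indexed by `Fin m × Fin n`. -/
def partialTranspose {m n : ℕ} (X : Matrix (Fin m × Fin n) (Fin m × Fin n) ℂ) :
    Matrix (Fin m × Fin n) (Fin m × Fin n) ℂ :=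
  Matrix.of fun p q => X (p.1, q.2) (q.1, p.2)

/-- A state is absolutely PPT if every unitary conjugate has positive semidefinite
partial transpose. -/
def AbsolutelyPPT {m n : ℕ} (ρ : Matrix (Fin m × Fin n) (Fin m × Fin n) ℂ) : Prop :=
  ∀ U : Matrix (Fin m × Fin n) (Fin m × Fin n) ℂ,
    U ∈ Matrix.unitaryGroup (Fin m × Fin n) ℂ →
      (partialTranspose (U * ρ * Uᴴ)).PosSemidef

/-- The swap operator on `ℂⁿ ⊗ ℂⁿ`. -/
def swapOp (n : ℕ) : Matrix (Fin n × Fin n) (Fin n × Fin n) ℂ :=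
  Matrix.of fun p q => if p.1 = q.2 ∧ p.2 = q.1 then 1 else 0

section Reflections

variable {ι 𝕜 : Type*} [Fintype ι] [DecidableEq ι] [RCLike 𝕜]

open Unitary in
lemma Matrix.IsHermitian.eigenvalues_eq_one_or_neg_one {A : Matrix ι ι 𝕜} (hA : A.IsHermitian)
    (h : A * A = 1) (i : ι) : hA.eigenvalues i = 1 ∨ hA.eigenvalues i = -1 := by
  have hd := hA.conjStarAlgAut_star_eigenvectorUnitary
  have hsq := congrArg (conjStarAlgAut 𝕜 _ (star hA.eigenvectorUnitary)) h
  rw [map_mul, map_one, hd, diagonal_mul_diagonal] at hsq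
  have hi := congrFun (congrFun hsq i) i
  simp only [diagonal_apply_eq, Function.comp_apply, one_apply_eq] at hi
  exact mul_self_eq_one_iff.mp (by exact_mod_cast hi)

open Polynomial in
/-- The characteristic polynomial of a Hermitian involution only depends on its trace. -/
lemma Matrix.IsHermitian.charpoly_eq_of_mul_self_eq_one {A B : Matrix ι ι 𝕜}
    (hA : A.IsHermitian) (hB : B.IsHermitian) (hA1 : A * A = 1) (hB1 : B * B = 1)
    (htr : A.trace = B.trace) : A.charpoly = B.charpoly := by
  have key : ∀ {C : Matrix ι ι 𝕜} (hC : C.IsHermitian), C * C = 1 → ∃ k : ℕ,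
      k ≤ Fintype.card ι ∧ C.trace = 2 * k - Fintype.card ι ∧
      C.charpoly = (X - 1) ^ k * (X + 1) ^ (Fintype.card ι - k) := by
    intro C hC hC1
    classical
    have hcard := Finset.card_filter_add_card_filter_not (s := Finset.univ)
      (fun i => hC.eigenvalues i = 1)
    rw [Finset.card_univ] at hcard
    refine ⟨(Finset.univ.filter fun i => hC.eigenvalues i = 1).card, by omega, ?_, ?_⟩
    · rw [hC.trace_eq_sum_eigenvalues, ← hcard]
      have hs : ∑ i, (hC.eigenvalues i : 𝕜) =
          ∑ i, if hC.eigenvalues i = 1 then (1 : 𝕜) else -1 :=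
        Finset.sum_congr rfl fun i _ => by
          rcases hC.eigenvalues_eq_one_or_neg_one hC1 i with h | h <;> rw [h] <;> norm_num
      rw [hs, Finset.sum_ite]
      simp only [Finset.sum_const, nsmul_eq_mul]
      push_cast
      ring
    · have hs : ∏ i, (X - Polynomial.C (hC.eigenvalues i : 𝕜)) =
          ∏ i, if hC.eigenvalues i = 1 then X - 1 else X + 1 :=
        Finset.prod_congr rfl fun i _ => by
          rcases hC.eigenvalues_eq_one_or_neg_one hC1 i with h | h <;> rw [h] <;> norm_num
      rw [hC.charpoly_eq, hs, Finset.prod_ite, Finset.prod_const, Finset.prod_const,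
        ← hcard, Nat.add_sub_cancel_left]
  obtain ⟨k, hk, hkt, hkp⟩ := key hA hA1
  obtain ⟨l, hl, hlt, hlp⟩ := key hB hB1
  have hkl : k = l := by
    rw [hkt, hlt] at htr
    have : (k : 𝕜) = l := by linear_combination htr / 2
    exact_mod_cast this
  rw [hkp, hlp, hkl]

open Unitary in
/-- Hermitian involutions with the same trace are unitarily conjugate. -/
lemma Matrix.IsHermitian.exists_unitary_conj_eq {A B : Matrix ι ι 𝕜}
    (hA : A.IsHermitian) (hB : B.IsHermitian) (hA1 : A * A = 1) (hB1 : B * B = 1)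
    (htr : A.trace = B.trace) : ∃ U ∈ unitaryGroup ι 𝕜, U * A * Uᴴ = B := by
  have he := (hA.eigenvalues_eq_eigenvalues_iff hB).mpr
    (hA.charpoly_eq_of_mul_self_eq_one hB hA1 hB1 htr)
  let U := hB.eigenvectorUnitary * star hA.eigenvectorUnitary
  refine ⟨U, U.2, ?_⟩
  have h : conjStarAlgAut 𝕜 _ U A = B := by
    rw [conjStarAlgAut_mul_apply, hA.conjStarAlgAut_star_eigenvectorUnitary, he]
    exact hB.spectral_theorem.symm
  rw [← h, conjStarAlgAut_apply]
  rfl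

end Reflections

section Swap

variable {n : ℕ}

lemma swapOp_mul_apply (M : Matrix (Fin n × Fin n) (Fin n × Fin n) ℂ) (p q : Fin n × Fin n) :
    (swapOp n * M) p q = M p.swap q := by
  rw [mul_apply, Finset.sum_eq_single p.swap]
  · simp [swapOp]
  · intro r _ hr
    have : ¬ (p.1 = r.2 ∧ p.2 = r.1) := fun h => hr (Prod.ext h.2.symm h.1.symm)
    simp [swapOp, this]
  · simp

lemma swapOp_isHermitian : (swapOp n).IsHermitian := by
  ext p q
  simp only [swapOp, conjTranspose_apply, of_apply, apply_ite star, star_one, star_zero]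
  exact if_congr ⟨fun h => ⟨h.2.symm, h.1.symm⟩, fun h => ⟨h.2.symm, h.1.symm⟩⟩ rfl rfl

lemma swapOp_mul_self : swapOp n * swapOp n = 1 := by
  ext p q
  rw [swapOp_mul_apply]
  simp only [swapOp, of_apply, one_apply, Prod.fst_swap, Prod.snd_swap, Prod.ext_iff]
  exact if_congr and_comm rfl rfl

lemma trace_swapOp : (swapOp n).trace = n := by
  simp only [trace, diag_apply, swapOp, of_apply, Fintype.sum_prod_type]
  simp [and_iff_left_of_imp (fun h : _ = _ => Eq.symm h)]

/-- The indicator function of the complement of `o`. -/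
def complIndicator (o i : Fin n) : ℝ := if i = o then 0 else 1

lemma complIndicator_mul_self (o i : Fin n) :
    complIndicator o i * complIndicator o i = complIndicator o i := by
  unfold complIndicator; split_ifs <;> simp

lemma sum_complIndicator (o : Fin n) : ∑ i, complIndicator o i = (n : ℝ) - 1 := by
  have h : ∀ i, complIndicator o i = 1 - if i = o then 1 else 0 := fun i => by
    unfold complIndicator; split_ifs <;> simp
  simp [h]

/-- The projection onto `W ⊗ W`, where `W` is spanned by the basis vectors other than `o`. -/
def coordProj (o : Fin n) : Matrix (Fin n × Fin n) (Fin n × Fin n) ℂ :=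
  diagonal fun p => (complIndicator o p.1 * complIndicator o p.2 : ℝ)

lemma coordProj_mul_self (o : Fin n) : coordProj o * coordProj o = coordProj o := by
  rw [coordProj, diagonal_mul_diagonal]
  congr 1
  ext p
  rw [← Complex.ofReal_mul, mul_mul_mul_comm, complIndicator_mul_self, complIndicator_mul_self]

lemma coordProj_isHermitian (o : Fin n) : (coordProj o).IsHermitian := by
  refine isHermitian_diagonal_iff.mpr fun p => ?_
  exact Complex.conj_ofReal _

lemma commute_coordProj_swapOp (o : Fin n) : Commute (coordProj o) (swapOp n) := by
  ext p q
  rw [swapOp_mul_apply, coordProj, diagonal_mul, diagonal_apply]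
  simp only [swapOp, of_apply, Prod.ext_iff, Prod.fst_swap, Prod.snd_swap]
  rw [mul_comm (complIndicator o p.2)]
  split_ifs <;> simp_all

/-- The reflection equal to `-1` exactly on the symmetric part of `W ⊗ W`, where `W` is spanned
by the basis vectors other than `o`. -/
def symReflection (o : Fin n) : Matrix (Fin n × Fin n) (Fin n × Fin n) ℂ :=
  1 - coordProj o * (1 + swapOp n)

lemma symReflection_isHermitian (o : Fin n) : (symReflection o).IsHermitian := by
  have h1 : (1 + swapOp n).IsHermitian := isHermitian_one.add swapOp_isHermitian
  refine isHermitian_one.sub ?_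
  exact ((coordProj_isHermitian o).commute_iff h1).mp
    ((Commute.one_right _).add_right (commute_coordProj_swapOp o))

lemma symReflection_mul_self (o : Fin n) : symReflection o * symReflection o = 1 := by
  have hc : Commute (1 + swapOp n) (coordProj o) :=
    ((Commute.one_right _).add_right (commute_coordProj_swapOp o)).symm
  have hq : coordProj o * (1 + swapOp n) * (coordProj o * (1 + swapOp n)) =
      2 • (coordProj o * (1 + swapOp n)) := by
    calc _ = coordProj o * ((1 + swapOp n) * coordProj o) * (1 + swapOp n) := by noncomm_ring
      _ = coordProj o * coordProj o * (1 + 2 • swapOp n + swapOp n * swapOp n) := by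
        rw [hc.eq]; noncomm_ring
      _ = _ := by rw [coordProj_mul_self, swapOp_mul_self]; noncomm_ring
  rw [symReflection, sub_mul, mul_sub, mul_sub, hq, one_mul, mul_one, one_mul]
  abel

lemma symReflection_apply (o : Fin n) (p q : Fin n × Fin n) :
    symReflection o p q = (1 : Matrix (Fin n × Fin n) (Fin n × Fin n) ℂ) p q -
      (complIndicator o p.1 * complIndicator o p.2 : ℝ) *
        ((1 : Matrix (Fin n × Fin n) (Fin n × Fin n) ℂ) p q + swapOp n p q) := by
  rw [symReflection, coordProj, Matrix.sub_apply, diagonal_mul, Matrix.add_apply]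

lemma trace_symReflection (o : Fin n) : (symReflection o).trace = n := by
  have hs : ∀ i j : Fin n, swapOp n (i, j) (i, j) = if i = j then 1 else 0 := fun i j =>
    if_congr (and_iff_left_of_imp Eq.symm) rfl rfl
  have hsum : ∑ i, (complIndicator o i : ℂ) = (n : ℂ) - 1 := by
    exact_mod_cast congrArg (fun x : ℝ => (x : ℂ)) (sum_complIndicator o)
  have hsq : ∀ i, (complIndicator o i : ℂ) * complIndicator o i = complIndicator o i := fun i => by
    exact_mod_cast congrArg (fun x : ℝ => (x : ℂ)) (complIndicator_mul_self o i)
  simp only [trace, diag_apply, Fintype.sum_prod_type, symReflection_apply, one_apply_eq, hs,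
    Complex.ofReal_mul, mul_add, mul_one, mul_ite, mul_zero, Finset.sum_sub_distrib,
    Finset.sum_add_distrib, Finset.sum_ite_eq, Finset.mem_univ, if_true, hsq,
    ← Finset.mul_sum, ← Finset.sum_mul, hsum]
  simp only [Finset.sum_const, Finset.card_univ, Fintype.card_fin, nsmul_eq_mul, mul_one]
  ring

end Swap

section Witness

variable {n : ℕ}

/-- The quadratic form of a partial transpose at the vector `∑ i, f i • |i i⟩`. -/
lemma star_dotProduct_partialTranspose_mulVec
    (X : Matrix (Fin n × Fin n) (Fin n × Fin n) ℂ) (f : Fin n → ℝ) :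
    (star fun p : Fin n × Fin n => if p.1 = p.2 then (f p.1 : ℂ) else 0) ⬝ᵥ
      (partialTranspose X *ᵥ fun p => if p.1 = p.2 then (f p.1 : ℂ) else 0) =
    ∑ i, ∑ j, (f i : ℂ) * f j * X (i, j) (j, i) := by
  simp only [dotProduct, mulVec, Fintype.sum_prod_type, Pi.star_apply, apply_ite star, star_zero,
    mul_ite, mul_zero, ite_mul, zero_mul, Finset.sum_ite_eq, Finset.mem_univ, if_true,
    Finset.mul_sum, partialTranspose, of_apply]
  refine Finset.sum_congr rfl fun i _ => ?_
  rw [Finset.sum_eq_single i (fun j _ hj => by simp [hj.symm]) (by simp)]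
  refine Finset.sum_congr rfl fun j _ => ?_
  rw [if_pos rfl, Complex.star_def, Complex.conj_ofReal]
  ring

lemma not_posSemidef_partialTranspose_of_lt {c α : ℝ} (hc : 0 < c)
    (Y : Matrix (Fin n × Fin n) (Fin n × Fin n) ℂ) (f : Fin n → ℝ) {s t : ℝ}
    (hs : ∑ i, f i * f i = s)
    (ht : ∑ i, ∑ j, (f i : ℂ) * f j * Y (i, j) (j, i) = (t : ℂ)) (hlt : s < α * t) :
    ¬ (partialTranspose ((c : ℂ) • (1 - (α : ℂ) • Y))).PosSemidef := by
  intro h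
  have h0 := h.dotProduct_mulVec_nonneg fun p => if p.1 = p.2 then (f p.1 : ℂ) else 0
  rw [star_dotProduct_partialTranspose_mulVec] at h0
  have h1 : ∑ i, ∑ j, (f i : ℂ) * f j *
      (1 : Matrix (Fin n × Fin n) (Fin n × Fin n) ℂ) (i, j) (j, i) = (s : ℂ) := by
    rw [← hs]
    push_cast
    refine Finset.sum_congr rfl fun i _ => ?_
    rw [Finset.sum_eq_single i]
    · simp
    · intro j _ hj
      simp [one_apply, hj]
    · simp
  have h2 : ∑ i, ∑ j, (f i : ℂ) * f j * ((c : ℂ) • (1 - (α : ℂ) • Y)) (i, j) (j, i) =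
      ((c * (s - α * t) : ℝ) : ℂ) := by
    push_cast
    rw [← h1, ← ht]
    simp only [Finset.mul_sum, ← Finset.sum_sub_distrib]
    refine Finset.sum_congr rfl fun i _ => Finset.sum_congr rfl fun j _ => ?_
    simp only [Matrix.smul_apply, Matrix.sub_apply, smul_eq_mul]
    ring
  rw [h2, Complex.zero_le_real] at h0
  nlinarith

lemma sum_swapOp_diag : ∑ i : Fin n, ∑ j : Fin n,
    ((1 : ℝ) : ℂ) * (1 : ℝ) * swapOp n (i, j) (j, i) = ((n * n : ℝ) : ℂ) := by
  simp [swapOp]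

lemma sum_symReflection_diag (o : Fin n) : ∑ i, ∑ j,
    (complIndicator o i : ℂ) * complIndicator o j * symReflection o (i, j) (j, i) =
      ((-((n - 1) * (n - 1)) : ℝ) : ℂ) := by
  rw [← sum_complIndicator o, Finset.sum_mul_sum, ← Finset.sum_neg_distrib]
  push_cast
  refine Finset.sum_congr rfl fun i _ => ?_
  rw [← Finset.sum_neg_distrib]
  refine Finset.sum_congr rfl fun j _ => ?_
  rw [symReflection_apply]
  have hs : swapOp n (i, j) (j, i) = 1 := by simp [swapOp]
  rw [hs]
  by_cases hi : i = o <;> by_cases hj : j = o <;> simp [complIndicator, hi, hj]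

end Witness

/-- Werner states with `α < -1/(n-1)` or `α > 1/n` are not absolutely PPT. -/
theorem werner_not_absolutely_PPT {n : ℕ} (hn : 2 ≤ n) (α : ℝ)
    (hα₁ : -1 ≤ α) (hα₂ : α ≤ 1)
    (hα : α < -(1 / ((n : ℝ) - 1)) ∨ 1 / (n : ℝ) < α) :
    ∃ U : Matrix (Fin n × Fin n) (Fin n × Fin n) ℂ,
      U ∈ Matrix.unitaryGroup (Fin n × Fin n) ℂ ∧
      ¬ (partialTranspose
          (U * (((1 : ℂ) / ((n : ℂ) ^ 2 - (n : ℂ) * (α : ℂ))) •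
            ((1 : Matrix (Fin n × Fin n) (Fin n × Fin n) ℂ) - (α : ℂ) • swapOp n)) *
            Uᴴ)).PosSemidef := by
  have hn' : (2 : ℝ) ≤ n := by exact_mod_cast hn
  have hc : 0 < 1 / ((n : ℝ) ^ 2 - n * α) := one_div_pos.mpr (by nlinarith)
  have hcast : (1 : ℂ) / ((n : ℂ) ^ 2 - (n : ℂ) * (α : ℂ)) =
      ((1 / ((n : ℝ) ^ 2 - n * α) : ℝ) : ℂ) := by
    push_cast
    rfl
  have hconj : ∀ U ∈ unitaryGroup (Fin n × Fin n) ℂ, ∀ c : ℂ,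
      U * (c • (1 - (α : ℂ) • swapOp n)) * Uᴴ =
        c • (1 - (α : ℂ) • (U * swapOp n * Uᴴ)) := by
    intro U hU c
    have hU1 : U * Uᴴ = 1 := mem_unitaryGroup_iff.mp hU
    simp only [mul_smul_comm, smul_mul_assoc, mul_sub, sub_mul, mul_one, hU1]
  rw [hcast]
  rcases hα with h | h
  · let o : Fin n := ⟨0, by omega⟩
    obtain ⟨U, hU, hUS⟩ := swapOp_isHermitian.exists_unitary_conj_eq
      (symReflection_isHermitian o) swapOp_mul_self (symReflection_mul_self o)
      (trace_swapOp.trans (trace_symReflection o).symm)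
    refine ⟨U, hU, ?_⟩
    rw [hconj U hU, hUS]
    refine not_posSemidef_partialTranspose_of_lt hc _ (complIndicator o) (s := n - 1)
      (by simp only [complIndicator_mul_self, sum_complIndicator]) (sum_symReflection_diag o) ?_
    have hm : 0 < (n : ℝ) - 1 := by linarith
    have h1 : 1 < -α * ((n : ℝ) - 1) := (div_lt_iff₀ hm).mp (by linarith)
    nlinarith
  · refine ⟨1, one_mem _, ?_⟩
    rw [hconj 1 (one_mem _), conjTranspose_one, one_mul, mul_one]
    refine not_posSemidef_partialTranspose_of_lt hc _ (fun _ => 1) (s := n) (by simp) sum_swapOp_diag ?_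
    have h1 : 1 < α * (n : ℝ) := (div_lt_iff₀ (by linarith)).mp h
    nlinarith

end
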